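/- Let T be a tree on n vertices, E its edge set, f a non-edge of T, B = E ∪ {f}, and N = Min4PC_T[B,B]. Write CharPoly_N(x) = Σ_{k=0}^n a_k x^k. Then the sequence |a_0|, |a_1|, ..., |a_{n−2}| is unimodal and log-concave; moreover, if t is an index with |a_t| = max_{0 ≤ k ≤ n−2} |a_k|, then ⌊(n−2)/3⌋ ≤ t ≤ ⌈(n+1)/3⌉. -/

import Mathlib

open Polynomial

/-- The Min4PC value of two 2-element subsets of vertices (represented as elements of `Sym2`),
with respect to a distance function `d`:
`Min4PC({i,j},{k,l}) = min { d(i,j)+d(k,l), d(i,k)+d(j,l), d(i,l)+d(j,k) }`. -/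
noncomputable def min4PC {V : Type*} (d : V → V → ℕ) (e e' : Sym2 V) : ℕ :=
  min (d e.out.1 e.out.2 + d e'.out.1 e'.out.2)
    (min (d e.out.1 e'.out.1 + d e.out.2 e'.out.2)
      (d e.out.1 e'.out.2 + d e.out.2 e'.out.1))

/-- A finite real sequence `b 0, b 1, ..., b m` is unimodal if there is an index `k` such that
`b (j-1) ≤ b j` for all `j ≤ k` and `b j ≥ b (j+1)` for all `j ≥ k`. -/
def IsUnimodalSeq (b : ℕ → ℝ) (m : ℕ) : Prop :=
  ∃ k, k ≤ m ∧ (∀ j, 1 ≤ j → j ≤ k → b (j - 1) ≤ b j) ∧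
    (∀ j, k ≤ j → j + 1 ≤ m → b (j + 1) ≤ b j)

/-- A finite real sequence `b 0, b 1, ..., b m` is log-concave if
`b i ^ 2 ≥ b (i-1) * b (i+1)` for all `1 ≤ i ≤ m - 1`. -/
def IsLogConcaveSeq (b : ℕ → ℝ) (m : ℕ) : Prop :=
  ∀ i, 1 ≤ i → i + 1 ≤ m → b (i - 1) * b (i + 1) ≤ b i ^ 2

theorem Polynomial.Splits.derivative_real {p : ℝ[X]} (hp : p.Splits) : (derivative p).Splits := by
  rw [splits_iff_card_roots] at hp ⊢
  have h1 := card_roots_le_derivative p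
  have h2 := card_roots' (derivative p)
  have h3 := natDegree_derivative_le p
  by_cases h0 : p.natDegree = 0
  · have : derivative p = 0 := derivative_of_natDegree_zero h0
    simp [this]
  · omega

theorem Polynomial.Splits.eval_mul_eval_derivative_derivative_le {p : ℝ[X]} (hp : p.Splits)
    (x : ℝ) : p.eval x * (derivative (derivative p)).eval x ≤ (derivative p).eval x ^ 2 := by
  induction hp using Submonoid.closure_induction with
  | mem q hq =>
    rcases hq with ⟨a, rfl⟩ | ⟨a, rfl⟩
    · simp
    · simp
  | one => simp
  | mul q r _ _ hq hr =>
    simp only [derivative_mul, derivative_add, eval_add, eval_mul]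
    nlinarith [mul_le_mul_of_nonneg_left hq (sq_nonneg (r.eval x)),
      mul_le_mul_of_nonneg_left hr (sq_nonneg (q.eval x))]

theorem Polynomial.Splits.coeff_mul_coeff_le {p : ℝ[X]} (hp : p.Splits) (k : ℕ) :
    p.coeff k * p.coeff (k + 2) ≤ p.coeff (k + 1) ^ 2 := by
  have hq : ∀ m, (derivative^[m] p).Splits := fun m => by
    induction m with
    | zero => exact hp
    | succ m ih => rw [Function.iterate_succ_apply']; exact ih.derivative_real
  have h := (hq k).eval_mul_eval_derivative_derivative_le 0
  rw [← Function.iterate_succ_apply' derivative, ← Function.iterate_succ_apply' derivative] at h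
  simp only [← coeff_zero_eq_eval_zero, coeff_iterate_derivative, zero_add,
    Nat.descFactorial_self, nsmul_eq_mul, Nat.factorial_succ, Nat.cast_mul] at h
  have h' : (k + 2 : ℝ) * (p.coeff k * p.coeff (k + 2)) ≤ (k + 1) * p.coeff (k + 1) ^ 2 := by
    have hc : (0 : ℝ) < (k.factorial : ℝ) ^ 2 * (k + 1) := by positivity
    refine le_of_mul_le_mul_left ?_ hc
    push_cast at h
    linear_combination h
  have hsq := sq_nonneg (p.coeff (k + 1))
  have hk0 : (0 : ℝ) ≤ k := k.cast_nonneg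
  by_contra! hlt
  nlinarith

/-- A positive log-concave sequence is unimodal. -/
theorem IsLogConcaveSeq.isUnimodalSeq {b : ℕ → ℝ} {m : ℕ} (hlc : IsLogConcaveSeq b m)
    (hpos : ∀ k ≤ m, 0 < b k) : IsUnimodalSeq b m := by
  obtain ⟨k, hk, hmax⟩ := Finset.exists_max_image (Finset.range (m + 1)) b ⟨0, by simp⟩
  simp only [Finset.mem_range, Nat.lt_succ_iff] at hk hmax
  have descend : ∀ i j, i ≤ j → b (i + 1) < b i → j + 1 ≤ m → b (j + 1) < b j := by
    intro i j hij h
    induction j, hij using Nat.le_induction with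
    | base => exact fun _ => h
    | succ j _ ih =>
      intro hj
      have h1 := hlc (j + 1) (by omega) hj
      have h2 := hpos (j + 1) (by omega)
      have h3 := hpos (j + 1 + 1) hj
      have h4 := ih (by omega)
      rw [Nat.add_sub_cancel] at h1
      by_contra! hle
      nlinarith
  refine ⟨k, hk, fun j hj1 hjk => ?_, fun j hkj hjm => ?_⟩
  · by_contra! hlt
    obtain ⟨i, rfl⟩ := Nat.exists_eq_add_of_le' hj1
    have below : ∀ l, i + 1 ≤ l → l ≤ m → b l < b i := fun l hl => by
      induction l, hl using Nat.le_induction with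
      | base => exact fun _ => hlt
      | succ l hl ih =>
        exact fun hlm => (descend i l (by omega) hlt hlm).trans (ih (by omega))
    exact absurd (hmax i (by omega)) (not_le.2 (below k hjk hk))
  · by_contra! hlt
    have above : ∀ l, k ≤ l → l ≤ j → b k ≤ b l := fun l hl => by
      induction l, hl using Nat.le_induction with
      | base => exact fun _ => le_rfl
      | succ l hl ih =>
        intro hlj
        refine (ih (by omega)).trans (not_lt.1 fun h => ?_)
        exact lt_asymm hlt (descend l j (by omega) h hjm)
    linarith [above j hkj le_rfl, hmax (j + 1) hjm]

/-- The coefficients of `(X + 2) ^ N`, shifted by three places. -/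
noncomputable def shiftedBinomial (N j : ℕ) : ℝ := (((X + C 2) ^ N * X ^ 3 : ℝ[X])).coeff j

theorem shiftedBinomial_add_three (N k : ℕ) :
    shiftedBinomial N (k + 3) = 2 ^ (N - k) * (N.choose k : ℝ) := by
  rw [shiftedBinomial, coeff_mul_X_pow, coeff_X_add_C_pow]

theorem shiftedBinomial_of_lt_three {N j : ℕ} (hj : j < 3) : shiftedBinomial N j = 0 := by
  rw [shiftedBinomial, coeff_mul_X_pow', if_neg (by omega)]

theorem shiftedBinomial_nonneg (N j : ℕ) : 0 ≤ shiftedBinomial N j := by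
  rcases lt_or_ge j 3 with hj | hj
  · exact (shiftedBinomial_of_lt_three hj).ge
  · obtain ⟨k, rfl⟩ := Nat.exists_eq_add_of_le' hj
    rw [shiftedBinomial_add_three]
    positivity

theorem shiftedBinomial_pos {N j : ℕ} (hj : 3 ≤ j) (hjN : j ≤ N + 3) :
    0 < shiftedBinomial N j := by
  obtain ⟨k, rfl⟩ := Nat.exists_eq_add_of_le' hj
  rw [shiftedBinomial_add_three]
  have : 0 < N.choose k := Nat.choose_pos (by omega)
  positivity

theorem shiftedBinomial_succ (N j : ℕ) :
    (N + 3 - j : ℝ) * shiftedBinomial N j = 2 * (j - 2) * shiftedBinomial N (j + 1) := by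
  rcases lt_or_ge j 3 with hj | hj
  · rw [shiftedBinomial_of_lt_three hj]
    rcases (show j < 2 ∨ j = 2 by omega) with h2 | rfl
    · rw [shiftedBinomial_of_lt_three (by omega : j + 1 < 3)]; ring
    · norm_num
  · obtain ⟨k, rfl⟩ := Nat.exists_eq_add_of_le' hj
    rw [show k + 3 + 1 = (k + 1) + 3 by ring, shiftedBinomial_add_three, shiftedBinomial_add_three]
    push_cast
    rcases lt_trichotomy k N with hk | rfl | hk
    · have h := Nat.choose_succ_right_eq N k
      have h' : (N.choose (k + 1) : ℝ) * (k + 1) = N.choose k * (N - k) := by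
        rw [← Nat.cast_sub hk.le]; exact_mod_cast h
      rw [show N - k = N - (k + 1) + 1 by omega, pow_succ]
      linear_combination (-2 * 2 ^ (N - (k + 1))) * h'
    · simp
    · simp [Nat.choose_eq_zero_of_lt hk, Nat.choose_eq_zero_of_lt (hk.trans (Nat.lt_succ_self k))]

theorem coeff_X_add_two_pow_mul_cubic (N : ℕ) (a b c : ℝ) (k : ℕ) :
    ((X + C 2) ^ N * (X ^ 3 - C a * X ^ 2 - C b * X - C c) : ℝ[X]).coeff k =
      shiftedBinomial N k - a * shiftedBinomial N (k + 1) - b * shiftedBinomial N (k + 2)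
        - c * shiftedBinomial N (k + 3) := by
  have h : ∀ i, i ≤ 3 → ((X + C 2) ^ N * X ^ (3 - i) : ℝ[X]).coeff k =
      shiftedBinomial N (k + i) := fun i hi => by
    rw [shiftedBinomial, ← coeff_mul_X_pow _ i, mul_assoc, ← pow_add, Nat.sub_add_cancel hi]
  have e : ((X + C 2) ^ N * (X ^ 3 - C a * X ^ 2 - C b * X - C c) : ℝ[X]) =
      (X + C 2) ^ N * X ^ (3 - 0) - C a * ((X + C 2) ^ N * X ^ (3 - 1))
        - C b * ((X + C 2) ^ N * X ^ (3 - 2)) - C c * ((X + C 2) ^ N * X ^ (3 - 3)) := by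
    norm_num; ring
  rw [e, coeff_sub, coeff_sub, coeff_sub, coeff_C_mul, coeff_C_mul, coeff_C_mul, h 0 (by omega),
    h 1 (by omega), h 2 (by omega), h 3 le_rfl, Nat.add_zero]

section Cubic

variable {N : ℕ} {b c : ℝ}

theorem coeff_X_add_two_pow_mul_cubic_neg (hb : 0 < b) (hc : 0 < c) {k : ℕ} (hk : k ≤ N + 1) :
    ((X + C 2) ^ N * (X ^ 3 - C (2 * (N : ℝ)) * X ^ 2 - C b * X - C c) : ℝ[X]).coeff k < 0 := by
  rw [coeff_X_add_two_pow_mul_cubic]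
  have hkN : (k : ℝ) ≤ N + 1 := by exact_mod_cast hk
  have h0 := shiftedBinomial_succ N k
  have p0 := shiftedBinomial_nonneg N k
  have p1 := shiftedBinomial_nonneg N (k + 1)
  have p2 := mul_nonneg hb.le (shiftedBinomial_nonneg N (k + 2))
  have p3 := mul_nonneg hc.le (shiftedBinomial_nonneg N (k + 3))
  have h1 : shiftedBinomial N k ≤ 2 * N * shiftedBinomial N (k + 1) := by
    have hN : (0 : ℝ) ≤ N := N.cast_nonneg
    nlinarith
  rcases Nat.eq_zero_or_pos k with rfl | hk0
  · have := mul_pos hc (shiftedBinomial_pos (N := N) (j := 0 + 3) le_rfl (by omega))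
    linarith
  · have := mul_pos hb (shiftedBinomial_pos (N := N) (j := k + 2) (by omega) (by omega))
    linarith

theorem shiftedBinomial_le_succ {j : ℕ} (h : 3 * j ≤ N + 7) :
    shiftedBinomial N j ≤ shiftedBinomial N (j + 1) := by
  have h0 := shiftedBinomial_succ N j
  have p0 := shiftedBinomial_nonneg N j
  have p1 := shiftedBinomial_nonneg N (j + 1)
  have hj : (3 * j : ℝ) ≤ N + 7 := by exact_mod_cast h
  rcases lt_or_ge j 3 with hj3 | hj3
  · rwa [shiftedBinomial_of_lt_three hj3]
  · have : (3 : ℝ) ≤ j := by exact_mod_cast hj3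
    by_contra! hlt
    nlinarith

theorem shiftedBinomial_lt_succ {j : ℕ} (h : 3 * j < N + 7) (hj2 : 2 ≤ j) :
    shiftedBinomial N j < shiftedBinomial N (j + 1) := by
  have h0 := shiftedBinomial_succ N j
  have p0 := shiftedBinomial_nonneg N j
  have hj : (3 * j + 1 : ℝ) ≤ N + 7 := by exact_mod_cast h
  have p1 := shiftedBinomial_pos (N := N) (j := j + 1) (by omega) (by omega)
  rcases lt_or_ge j 3 with hj3 | hj3
  · rwa [shiftedBinomial_of_lt_three hj3]
  · have : (3 : ℝ) ≤ j := by exact_mod_cast hj3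
    by_contra! hlt
    nlinarith

theorem shiftedBinomial_succ_le {j : ℕ} (h : N + 7 ≤ 3 * j) :
    shiftedBinomial N (j + 1) ≤ shiftedBinomial N j := by
  have h0 := shiftedBinomial_succ N j
  have p0 := shiftedBinomial_nonneg N j
  have hj : (N + 7 : ℝ) ≤ 3 * j := by exact_mod_cast h
  have : (3 : ℝ) ≤ j := by exact_mod_cast (by omega : 3 ≤ j)
  by_contra! hlt
  nlinarith

theorem shiftedBinomial_succ_lt {j : ℕ} (h : N + 7 < 3 * j) (hjN : j ≤ N + 3) :
    shiftedBinomial N (j + 1) < shiftedBinomial N j := by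
  have h0 := shiftedBinomial_succ N j
  have p0 := shiftedBinomial_pos (N := N) (j := j) (by omega) hjN
  have hj : (N + 7 + 1 : ℝ) ≤ 3 * j := by exact_mod_cast h
  have : (3 : ℝ) ≤ j := by exact_mod_cast (by omega : 3 ≤ j)
  by_contra! hlt
  nlinarith

theorem coeff_X_add_two_pow_mul_cubic_succ_lt (hb : 0 < b) (hc : 0 < c) {k : ℕ} (hk : 3 * k + 2 ≤ N) :
    ((X + C 2) ^ N * (X ^ 3 - C (2 * (N : ℝ)) * X ^ 2 - C b * X - C c) : ℝ[X]).coeff (k + 1) <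
    ((X + C 2) ^ N * (X ^ 3 - C (2 * (N : ℝ)) * X ^ 2 - C b * X - C c) : ℝ[X]).coeff k := by
  simp only [coeff_X_add_two_pow_mul_cubic]
  have hkN : (3 * k + 2 : ℝ) ≤ N := by exact_mod_cast hk
  have h3 := mul_le_mul_of_nonneg_left
    (shiftedBinomial_le_succ (N := N) (j := k + 3) (by omega)) hc.le
  have h2 := mul_lt_mul_of_pos_left
    (shiftedBinomial_lt_succ (N := N) (j := k + 2) (by omega) (by omega)) hb
  have h1 : shiftedBinomial N (k + 1) - shiftedBinomial N k ≤
      2 * N * (shiftedBinomial N (k + 2) - shiftedBinomial N (k + 1)) := by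
    have p1 := shiftedBinomial_nonneg N (k + 1)
    rcases lt_or_ge k 2 with hk2 | hk2
    · rw [shiftedBinomial_of_lt_three (by omega : k < 3),
        shiftedBinomial_of_lt_three (by omega : k + 1 < 3)]
      have := shiftedBinomial_nonneg N (k + 2)
      simp only [sub_zero]
      positivity
    · have hk2' : (2 : ℝ) ≤ k := by exact_mod_cast hk2
      have e0 := shiftedBinomial_succ N k
      have e1 := shiftedBinomial_succ N (k + 1)
      push_cast at e1
      have hpos : (0 : ℝ) < 2 * (k - 1) * (N + 3 - k) := by
        apply mul_pos <;> linarith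
      refine le_of_mul_le_mul_left ?_ hpos
      have e2 : 2 * (k - 1) * (N + 3 - k) *
          (shiftedBinomial N (k + 1) - shiftedBinomial N k) =
          2 * (k - 1) * (N + 7 - 3 * k) * shiftedBinomial N (k + 1) := by
        linear_combination (-2 * (k - 1) : ℝ) * e0
      have e3 : 2 * (k - 1) * (N + 3 - k) *
          (2 * N * (shiftedBinomial N (k + 2) - shiftedBinomial N (k + 1))) =
          2 * N * (N + 3 - k) * (N + 4 - 3 * k) * shiftedBinomial N (k + 1) := by
        linear_combination (-(N + 3 - k) * (2 * N) : ℝ) * e1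
      rw [e2, e3]
      refine mul_le_mul_of_nonneg_right ?_ p1
      have q1 : (k - 1 : ℝ) * (N + 7 - 3 * k) ≤ (k - 1) * (2 * (N + 4 - 3 * k)) :=
        mul_le_mul_of_nonneg_left (by linarith) (by linarith)
      have q2 : (k - 1 : ℝ) * 2 ≤ N * (N + 3 - k) :=
        mul_le_mul (by linarith) (by linarith) (by norm_num) (by linarith)
      have q3 := mul_le_mul_of_nonneg_right q2 (by linarith : (0 : ℝ) ≤ N + 4 - 3 * k)
      linarith
  simp only [add_assoc, Nat.reduceAdd, add_comm 1] at *
  linarith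

theorem coeff_X_add_two_pow_mul_cubic_lt_succ (hb : 0 < b) (hc : 0 < c) {k : ℕ} (hk : N + 4 ≤ 3 * k)
    (hkN : k ≤ N) :
    ((X + C 2) ^ N * (X ^ 3 - C (2 * (N : ℝ)) * X ^ 2 - C b * X - C c) : ℝ[X]).coeff k <
    ((X + C 2) ^ N * (X ^ 3 - C (2 * (N : ℝ)) * X ^ 2 - C b * X - C c) : ℝ[X]).coeff (k + 1) := by
  simp only [coeff_X_add_two_pow_mul_cubic]
  have hkN' : (k : ℝ) ≤ N := by exact_mod_cast hkN
  have hk' : (N + 4 : ℝ) ≤ 3 * k := by exact_mod_cast hk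
  have h3 := mul_le_mul_of_nonneg_left
    (shiftedBinomial_succ_le (N := N) (j := k + 3) (by omega)) hc.le
  have h2 := mul_lt_mul_of_pos_left
    (shiftedBinomial_succ_lt (N := N) (j := k + 2) (by omega) (by omega)) hb
  have h1 : shiftedBinomial N k - shiftedBinomial N (k + 1) ≤
      2 * N * (shiftedBinomial N (k + 1) - shiftedBinomial N (k + 2)) := by
    have p1 := shiftedBinomial_nonneg N (k + 1)
    have hk2 : (2 : ℝ) ≤ k := by exact_mod_cast (by omega : 2 ≤ k)
    have e0 := shiftedBinomial_succ N k
    have e1 := shiftedBinomial_succ N (k + 1)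
    push_cast at e1
    have hpos : (0 : ℝ) < 2 * (k - 1) * (N + 3 - k) := by
      apply mul_pos <;> linarith
    refine le_of_mul_le_mul_left ?_ hpos
    have e2 : 2 * (k - 1) * (N + 3 - k) *
        (shiftedBinomial N k - shiftedBinomial N (k + 1)) =
        2 * (k - 1) * (3 * k - 7 - N) * shiftedBinomial N (k + 1) := by
      linear_combination (2 * (k - 1) : ℝ) * e0
    have e3 : 2 * (k - 1) * (N + 3 - k) *
        (2 * N * (shiftedBinomial N (k + 1) - shiftedBinomial N (k + 2))) =
        2 * N * (N + 3 - k) * (3 * k - 4 - N) * shiftedBinomial N (k + 1) := by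
      linear_combination ((N + 3 - k) * (2 * N) : ℝ) * e1
    rw [e2, e3]
    refine mul_le_mul_of_nonneg_right ?_ p1
    have q1 : (k - 1 : ℝ) * (3 * k - 7 - N) ≤ (k - 1) * (3 * k - 4 - N) :=
      mul_le_mul_of_nonneg_left (by linarith) (by linarith)
    have q2 : (k - 1 : ℝ) * 1 ≤ N * (N + 3 - k) :=
      mul_le_mul (by linarith) (by linarith) (by norm_num) (by linarith)
    have q3 := mul_le_mul_of_nonneg_right q2 (by linarith : (0 : ℝ) ≤ 3 * k - 4 - N)
    linarith
  simp only [add_assoc, Nat.reduceAdd, add_comm 1] at *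
  linarith

end Cubic

section CharPoly

variable {ι : Type*} [Fintype ι] [DecidableEq ι]

/-- The characteristic polynomial of the matrix with a zero diagonal, with off-diagonal entries
`2` outside row and column `i₀`, and whose row and column `i₀` are given by `c`. -/
theorem charpoly_bordered (hι : 3 ≤ Fintype.card ι) (i₀ : ι) (c : ι → ℝ) (hc : c i₀ = 0)
    (M : Matrix ι ι ℝ) (hdiag : ∀ i, M i i = 0) (hrow : ∀ j, M i₀ j = c j)
    (hcol : ∀ i, M i i₀ = c i) (hoff : ∀ i j, i ≠ i₀ → j ≠ i₀ → i ≠ j → M i j = 2) :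
    M.charpoly = (X + C 2) ^ (Fintype.card ι - 3) *
      (X ^ 3 - C (2 * ((Fintype.card ι - 3 : ℕ) : ℝ)) * X ^ 2
        - C (4 * ((Fintype.card ι : ℝ) - 2) + ∑ i, c i ^ 2) * X
        - C (2 * (∑ i, c i) ^ 2 - 2 * ((Fintype.card ι : ℝ) - 2) * ∑ i, c i ^ 2)) := by
  let e : ι → ℝ := Pi.single i₀ 1
  let U : Matrix ι (Fin 3) ℝ := Matrix.of fun i => ![1 - e i, e i, c i]
  let V : Matrix (Fin 3) ι ℝ := Matrix.of ![fun j => 2 * (1 - e j), fun j => 2 * e j + c j, e]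
  have hM : M = U * V - Matrix.scalar ι 2 := by
    ext i j
    simp only [Matrix.sub_apply, Matrix.mul_apply, Fin.sum_univ_three, U, V, Matrix.of_apply,
      Matrix.scalar_apply, Matrix.diagonal_apply]
    by_cases hi : i = i₀ <;> by_cases hj : j = i₀ <;> by_cases hij : i = j
    all_goals simp_all [e]
  have hVU : V * U = !![2 * ((Fintype.card ι : ℝ) - 1), 0, 2 * ∑ i, c i; ∑ i, c i, 2, ∑ i, c i ^ 2;
      0, 1, 0] := by
    have he2 : ∀ i, e i * e i = e i := fun i => by by_cases h : i = i₀ <;> simp [e, h]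
    have hec : ∀ i, e i * c i = 0 := fun i => by by_cases h : i = i₀ <;> simp [e, h, hc]
    have hes : ∑ i, e i = 1 := by simp [e]
    ext a b
    fin_cases a <;> fin_cases b <;> simp [Matrix.mul_apply, U, V]
    · rw [Finset.sum_congr rfl fun i _ => show 2 * (1 - e i) * (1 - e i) = 2 * (1 - e i) by
        linear_combination 2 * he2 i, ← Finset.mul_sum, Finset.sum_sub_distrib, hes]
      simp
    · exact Finset.sum_eq_zero fun i _ => by linear_combination -2 * he2 i
    · rw [Finset.mul_sum]
      exact Finset.sum_congr rfl fun i _ => by linear_combination -2 * hec i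
    · exact Finset.sum_congr rfl fun i _ => by linear_combination -2 * he2 i - hec i
    · rw [Finset.sum_congr rfl fun i _ => show (2 * e i + c i) * e i = 2 * e i by
        linear_combination 2 * he2 i + hec i, ← Finset.mul_sum, hes, mul_one]
    · exact Finset.sum_congr rfl fun i _ => by linear_combination 2 * hec i
    · exact Finset.sum_eq_zero fun i _ => by linear_combination -he2 i
    · rw [Finset.sum_congr rfl fun i _ => he2 i, hes]
    · exact Finset.sum_eq_zero fun i _ => hec i
  rw [hM, Matrix.charpoly_sub_scalar, Matrix.charpoly_mul_comm_of_le U V (by simpa using hι), hVU]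
  have hcard : (((Fintype.card ι - 3 : ℕ) : ℝ)) = Fintype.card ι - 3 := by
    push_cast [hι]; ring
  simp only [Fintype.card_fin, mul_comp, pow_comp, X_comp]
  congr 1
  rw [hcard, Matrix.charpoly, Matrix.det_fin_three]
  simp [Matrix.charmatrix]
  simp only [map_ofNat]
  ring

end CharPoly

namespace SimpleGraph

variable {V : Type*} {G : SimpleGraph V}

/-- A walk through the edge `s(k, l)` decomposes at that edge. -/
theorem Walk.dist_add_one_add_dist_le_length {u v k l : V} (p : G.Walk u v)
    (h : s(k, l) ∈ p.edges) :
    G.dist u k + 1 + G.dist l v ≤ p.length ∨ G.dist u l + 1 + G.dist k v ≤ p.length := by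
  induction p with
  | nil => simp at h
  | @cons a b c hab q ih =>
    rw [Walk.edges_cons, List.mem_cons] at h
    have htri : ∀ x, G.dist a x ≤ 1 + G.dist b x := fun x => by
      have := hab.reachable.dist_triangle_left x
      rwa [dist_eq_one_iff_adj.2 hab] at this
    rw [Walk.length_cons]
    rcases h with h | h
    · rcases Sym2.eq_iff.1 h with ⟨rfl, rfl⟩ | ⟨rfl, rfl⟩
      · left; have := dist_le q; simp; omega
      · right; have := dist_le q; simp; omega
    · have h1 := htri k
      have h2 := htri l
      rcases ih h with h | h
      · left; omega
      · right; omega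

/-- If `l` cannot be reached from `u` without using the edge `s(k, l)`, then a geodesic from `u` to
`l` passes through `k`. -/
theorem Connected.dist_eq_dist_add_one_of_not_reachable (hG : G.Connected) {u k l : V}
    (hkl : G.Adj k l) (h : ¬ (G.deleteEdges {s(k, l)}).Reachable u l) :
    G.dist u l = G.dist u k + 1 := by
  obtain ⟨p, hp⟩ := hG.exists_walk_length_eq_dist u l
  have hmem : s(k, l) ∈ p.edges := by
    by_contra hn
    exact h (reachable_deleteEdges_iff_exists_walk.2 ⟨p, hn⟩)
  have h1 := hG.dist_triangle (u := u) (v := k) (w := l)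
  rw [dist_eq_one_iff_adj.2 hkl] at h1
  rcases p.dist_add_one_add_dist_le_length hmem with h | h <;> omega

/-- If a walk from `u` to `v` in a tree avoids the edge `s(k, l)`, then joining `u` to `k` and `v`
to `l` is at least as expensive as joining `u` to `v` and `k` to `l`. -/
theorem IsTree.dist_add_one_le_of_notMem_edges (hG : G.IsTree) {u v k l : V} (p : G.Walk u v)
    (hkl : G.Adj k l) (h : s(k, l) ∉ p.edges) :
    G.dist u v + 1 ≤ G.dist u k + G.dist v l := by
  have hconn := hG.connected
  have huv : (G.deleteEdges {s(k, l)}).Reachable u v :=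
    reachable_deleteEdges_iff_exists_walk.2 ⟨p, h⟩
  have hbridge : ¬ (G.deleteEdges {s(k, l)}).Reachable k l :=
    isBridge_iff.1 (isAcyclic_iff_forall_isBridge.1 hG.isAcyclic (by simpa using hkl))
  by_cases hul : (G.deleteEdges {s(k, l)}).Reachable u l
  · have huk : ¬ (G.deleteEdges {s(l, k)}).Reachable u k := fun h' => by
      rw [Sym2.eq_swap] at h'
      exact hbridge (h'.symm.trans hul)
    have h1 := hconn.dist_eq_dist_add_one_of_not_reachable hkl.symm huk
    have h2 := hconn.dist_triangle (u := u) (v := l) (w := v)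
    rw [G.dist_comm (u := l)] at h2
    omega
  · have hvl : ¬ (G.deleteEdges {s(k, l)}).Reachable v l := fun h' => hul (huv.trans h')
    have h1 := hconn.dist_eq_dist_add_one_of_not_reachable hkl hvl
    have h2 := hconn.dist_triangle (u := u) (v := k) (w := v)
    rw [G.dist_comm (u := k)] at h2
    omega

end SimpleGraph

theorem min4PC_self {V : Type*} {d : V → V → ℕ} (hd : ∀ x, d x x = 0) (e : Sym2 V) :
    min4PC d e e = 0 := by
  simp [min4PC, hd]

theorem min4PC_comm {V : Type*} {d : V → V → ℕ} (hd : ∀ x y, d x y = d y x) (e e' : Sym2 V) :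
    min4PC d e e' = min4PC d e' e := by
  simp only [min4PC, hd e'.out.1 e.out.1, hd e'.out.1 e.out.2, hd e'.out.2 e.out.1,
    hd e'.out.2 e.out.2]
  omega

theorem Sym2.mk_out {V : Type*} (e : Sym2 V) : s(e.out.1, e.out.2) = e := e.out_eq

namespace SimpleGraph

variable {V : Type*} {G : SimpleGraph V}

theorem min4PC_add_one_of_mem_edges (hG : G.Connected) {f e : Sym2 V}
    (p : G.Walk f.out.1 f.out.2) (hp : p.length = G.dist f.out.1 f.out.2) (he : e ∈ p.edges) :
    min4PC G.dist f e + 1 = G.dist f.out.1 f.out.2 := by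
  have hadj : G.dist e.out.1 e.out.2 = 1 := by
    rw [dist_eq_one_iff_adj, ← mem_edgeSet, Sym2.mk_out]
    exact p.edges_subset_edgeSet he
  rw [← Sym2.mk_out e] at he
  have h := p.dist_add_one_add_dist_le_length he
  have t1 := hG.dist_triangle (u := f.out.1) (v := e.out.1) (w := f.out.2)
  have t2 := hG.dist_triangle (u := e.out.1) (v := e.out.2) (w := f.out.2)
  have t3 := hG.dist_triangle (u := f.out.1) (v := e.out.2) (w := f.out.2)
  have t4 := hG.dist_triangle (u := e.out.2) (v := e.out.1) (w := f.out.2)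
  rw [G.dist_comm (u := e.out.2) (v := e.out.1)] at t4
  simp only [min4PC, G.dist_comm (u := f.out.2)]
  omega

theorem IsTree.min4PC_of_notMem_edges (hG : G.IsTree) {f e : Sym2 V}
    (p : G.Walk f.out.1 f.out.2) (he : e ∈ G.edgeSet) (hep : e ∉ p.edges) :
    min4PC G.dist f e = G.dist f.out.1 f.out.2 + 1 := by
  rw [← Sym2.mk_out e] at he hep
  have h1 := hG.dist_add_one_le_of_notMem_edges (k := e.out.1) (l := e.out.2) p he hep
  rw [Sym2.eq_swap] at he hep
  have h2 := hG.dist_add_one_le_of_notMem_edges (k := e.out.2) (l := e.out.1) p he hep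
  have h3 : G.dist e.out.1 e.out.2 = 1 := dist_eq_one_iff_adj.2 (Adj.symm he)
  simp only [min4PC]
  omega

theorem IsTree.min4PC_edge_edge (hG : G.IsTree) {e e' : Sym2 V} (he : e ∈ G.edgeSet)
    (he' : e' ∈ G.edgeSet) (hne : e ≠ e') : min4PC G.dist e e' = 2 := by
  have hadj : G.Adj e.out.1 e.out.2 := by rwa [← mem_edgeSet, Sym2.mk_out]
  rw [hG.min4PC_of_notMem_edges hadj.toWalk he', dist_eq_one_iff_adj.2 hadj]
  simpa [Adj.toWalk, Sym2.mk_out] using hne.symm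

end SimpleGraph

/-- The characteristic polynomial of `Min4PC[B, B]`, for `B` the edges of a tree and a non-edge. -/
theorem exists_charpoly_min4PC_basis
    (n : ℕ) (T : SimpleGraph (Fin n)) (hT : T.IsTree)
    (f : Sym2 (Fin n)) (hf_diag : ¬ f.IsDiag) (hf_nonedge : f ∉ T.edgeSet)
    (b : Fin n → Sym2 (Fin n)) (hb_inj : Function.Injective b)
    (hb_range : Set.range b = T.edgeSet ∪ {f})
    (N : Matrix (Fin n) (Fin n) ℝ)
    (hN : N = Matrix.of fun i j => (min4PC T.dist (b i) (b j) : ℝ)) :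
    3 ≤ n ∧ ∃ β γ : ℝ, 0 < β ∧ 0 < γ ∧ N.charpoly = (X + C 2) ^ (n - 3) *
      (X ^ 3 - C (2 * ((n - 3 : ℕ) : ℝ)) * X ^ 2 - C β * X - C γ) := by
  obtain ⟨p, hp⟩ := hT.connected.exists_walk_length_eq_dist f.out.1 f.out.2
  have hpath := p.isPath_of_length_eq_dist hp
  set D := T.dist f.out.1 f.out.2
  have hD2 : 2 ≤ D := by
    refine hT.connected.one_lt_dist_of_ne_of_not_adj (fun h => hf_diag ?_) (fun h => hf_nonedge ?_)
    · rw [← Sym2.mk_out f]; exact h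
    · rwa [← SimpleGraph.mem_edgeSet, Sym2.mk_out] at h
  obtain ⟨i₀, hi₀⟩ : f ∈ Set.range b := by rw [hb_range]; simp
  have hedge : ∀ i, i ≠ i₀ → b i ∈ T.edgeSet := fun i hi => by
    have : b i ∈ T.edgeSet ∪ {f} := hb_range ▸ Set.mem_range_self i
    rcases this with h | h
    · exact h
    · exact absurd (hb_inj (h.trans hi₀.symm)) hi
  let S : Finset (Fin n) := {i | b i ∈ p.edges}
  have hS : S.card = D := by
    rw [← hp, ← p.length_edges, ← List.toFinset_card_of_nodup hpath.isTrail.edges_nodup,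
      ← Finset.card_image_of_injective S hb_inj]
    congr 1
    ext e
    simp only [S, Finset.mem_image, Finset.mem_filter_univ, List.mem_toFinset]
    refine ⟨by rintro ⟨i, hi, rfl⟩; exact hi, fun he => ?_⟩
    obtain ⟨i, rfl⟩ : e ∈ Set.range b := by
      rw [hb_range]; exact Or.inl (p.edges_subset_edgeSet he)
    exact ⟨i, he, rfl⟩
  have hi₀S : i₀ ∉ S := by
    simp only [S, Finset.mem_filter_univ, hi₀]
    exact fun h => hf_nonedge (p.edges_subset_edgeSet h)
  have hDn : D + 1 ≤ n := by
    have := Finset.card_le_univ (insert i₀ S)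
    rwa [Finset.card_insert_of_notMem hi₀S, hS, Fintype.card_fin] at this
  have hn : 3 ≤ n := by omega
  let c : Fin n → ℝ := fun i => (D + 1) - (if i ∈ S then 2 else 0) -
    (if i = i₀ then (D + 1 : ℝ) else 0)
  have hc : ∀ i, (min4PC T.dist f (b i) : ℝ) = c i := fun i => by
    by_cases hi : i = i₀
    · subst hi
      rw [hi₀, min4PC_self fun _ => T.dist_self]
      simp [c, hi₀S]
    · by_cases hiS : i ∈ S
      · have h := SimpleGraph.min4PC_add_one_of_mem_edges hT.connected p hp
          (by simpa [S] using hiS : b i ∈ p.edges)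
        have h' : (min4PC T.dist f (b i) : ℝ) + 1 = D := by exact_mod_cast h
        simp only [c, hi, hiS, if_true, if_false]
        linarith
      · rw [hT.min4PC_of_notMem_edges p (hedge i hi) (by simpa [S] using hiS)]
        simp [c, hi, hiS, D]
  have hc₀ : c i₀ = 0 := by simp [c, hi₀S]
  have hsum : ∑ i, c i = (n - 1) * (D + 1) - 2 * D := by
    simp only [c, Finset.sum_sub_distrib, Finset.sum_ite_mem, Finset.sum_ite_eq']
    simp [hS]
    ring
  have hsq : ∀ i, c i ^ 2 = (D + 1 : ℝ) ^ 2 - (if i ∈ S then (4 * D : ℝ) else 0)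
      - (if i = i₀ then (D + 1 : ℝ) ^ 2 else 0) := fun i => by
    by_cases hi : i = i₀
    · subst hi; simp [c, hi₀S]
    · by_cases hiS : i ∈ S <;> simp [c, hi, hiS]
      ring
  have hsumsq : ∑ i, c i ^ 2 = (n - 1) * (D + 1) ^ 2 - 4 * D ^ 2 := by
    simp only [hsq, Finset.sum_sub_distrib, Finset.sum_ite_mem, Finset.sum_ite_eq']
    simp [hS]
    ring
  have hn' : (3 : ℝ) ≤ n := by exact_mod_cast hn
  have hD2' : (2 : ℝ) ≤ D := by exact_mod_cast hD2
  have hchar := charpoly_bordered (by simpa using hn) i₀ c hc₀ N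
    (fun i => by simp [hN, min4PC_self fun _ => T.dist_self])
    (fun j => by rw [← hc j, hN, Matrix.of_apply, hi₀])
    (fun i => by
      rw [← hc i, hN, Matrix.of_apply, hi₀, min4PC_comm fun _ _ => T.dist_comm])
    (fun i j hi hj hij => by
      rw [hN, Matrix.of_apply,
        hT.min4PC_edge_edge (hedge i hi) (hedge j hj) (hb_inj.ne hij), Nat.cast_ofNat])
  simp only [Fintype.card_fin] at hchar
  refine ⟨hn, _, _, ?_, ?_, hchar⟩
  · have := Finset.sum_nonneg fun i (_ : i ∈ Finset.univ) => sq_nonneg (c i)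
    linarith
  · rw [hsum, hsumsq]
    have h : (0 : ℝ) < 2 * (n - 1) * (D - 1) ^ 2 := by
      have : (0 : ℝ) < n - 1 := by linarith
      have : (0 : ℝ) < D - 1 := by linarith
      positivity
    linear_combination h

/-- Let `T` be a tree on `n` vertices, `E` its edge set, `f` a non-edge of `T`,
`B = E ∪ {f}` and `N = Min4PC_T[B,B]`, with `CharPoly_N(x) = Σ_{k=0}^n a_k x^k`.  Then the
sequence `|a_0|, ..., |a_{n-2}|` is unimodal and log-concave; moreover, if `t` is an index with
`|a_t| = max_{0 ≤ k ≤ n-2} |a_k|`, then `⌊(n-2)/3⌋ ≤ t ≤ ⌈(n+1)/3⌉`. -/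
theorem unimodal_logConcave_peak_min4PC_basis
    (n : ℕ) (T : SimpleGraph (Fin n)) (hT : T.IsTree)
    (f : Sym2 (Fin n)) (hf_diag : ¬ f.IsDiag) (hf_nonedge : f ∉ T.edgeSet)
    (b : Fin n → Sym2 (Fin n)) (hb_inj : Function.Injective b)
    (hb_range : Set.range b = T.edgeSet ∪ {f})
    (N : Matrix (Fin n) (Fin n) ℝ)
    (hN : N = Matrix.of fun i j => (min4PC T.dist (b i) (b j) : ℝ)) :
    IsUnimodalSeq (fun k => |N.charpoly.coeff k|) (n - 2) ∧
    IsLogConcaveSeq (fun k => |N.charpoly.coeff k|) (n - 2) ∧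
    (∀ t, t ≤ n - 2 → (∀ k, k ≤ n - 2 → |N.charpoly.coeff k| ≤ |N.charpoly.coeff t|) →
      (n - 2) / 3 ≤ t ∧ t ≤ (n + 3) / 3) := by
  obtain ⟨hn, β, γ, hβ, hγ, hchar⟩ := exists_charpoly_min4PC_basis n T hT f hf_diag hf_nonedge b
    hb_inj hb_range N hN
  have hsplits : N.charpoly.Splits := by
    refine Matrix.IsHermitian.splits_charpoly (Matrix.IsHermitian.ext fun i j => ?_)
    rw [hN, Matrix.of_apply, Matrix.of_apply, min4PC_comm fun _ _ => T.dist_comm]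
    simp
  have hneg : ∀ k ≤ n - 2, N.charpoly.coeff k < 0 := fun k hk => by
    rw [hchar]
    exact coeff_X_add_two_pow_mul_cubic_neg hβ hγ (by omega)
  have hlc : IsLogConcaveSeq (fun k => |N.charpoly.coeff k|) (n - 2) := fun i hi him => by
    obtain ⟨k, rfl⟩ := Nat.exists_eq_add_of_le' hi
    have h := hsplits.coeff_mul_coeff_le k
    simp only [Nat.add_sub_cancel, sq_abs]
    rwa [abs_of_neg (hneg k (by omega)), abs_of_neg (hneg (k + 1 + 1) him), neg_mul_neg]
  refine ⟨hlc.isUnimodalSeq fun k hk => abs_pos.2 (hneg k hk).ne, hlc, fun t ht hmax => ?_⟩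
  constructor
  · by_contra! hlt
    have h1 := hmax (t + 1) (by omega)
    rw [abs_of_neg (hneg t ht), abs_of_neg (hneg (t + 1) (by omega)), hchar] at h1
    linarith [coeff_X_add_two_pow_mul_cubic_succ_lt hβ hγ (by omega : 3 * t + 2 ≤ n - 3)]
  · by_contra! hlt
    obtain ⟨k, rfl⟩ := Nat.exists_eq_add_of_le' (by omega : 1 ≤ t)
    have h1 := hmax k (by omega)
    rw [abs_of_neg (hneg k (by omega)), abs_of_neg (hneg (k + 1) ht), hchar] at h1
    linarith [coeff_X_add_two_pow_mul_cubic_lt_succ hβ hγ (by omega : n - 3 + 4 ≤ 3 * k) (by omega)]
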